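/- arXiv:2103.06608 — 3 statements merged into one kernel-verified Lean document; each statement's English description precedes it below -/
import Mathlib

section
/- Let C0 ≥ 0 and 0 < α ≤ 2. Suppose f : [0,∞) → [0,∞) is locally Lipschitz, satisfies f(t) − f(s) ≤ C0 ∫_s^t (1+τ)^(−α) dτ for all 0 ≤ s ≤ t, and is integrable on [0,∞), i.e. ∫_0^∞ f(t) dt < ∞. Then f(t) = o(t^(−α/2)) as t → ∞, i.e. lim_{t→∞} t^(α/2) f(t) = 0. -/
open MeasureTheory Filter Set

/-- On the upper half `[t/2, t]` an integrated derivative bound with density `(1+τ)^(-α)` is at most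
linear, with slope comparable to `t^(-α)`. -/
theorem integral_one_add_rpow_neg_le {α s t : ℝ} (hα0 : 0 < α) (hα2 : α ≤ 2) (ht : 0 < t)
    (hs : t / 2 ≤ s) (hst : s ≤ t) :
    ∫ τ in s..t, (1 + τ) ^ (-α) ≤ 4 * t ^ (-α) * (t - s) := by
  have hbound : ∀ τ ∈ Icc s t, (1 + τ) ^ (-α) ≤ 4 * t ^ (-α) := fun τ hτ => by
    have hτs : s ≤ τ := hτ.1
    calc (1 + τ) ^ (-α) ≤ (t / 2) ^ (-α) :=
          Real.rpow_le_rpow_of_nonpos (by linarith) (by linarith) (by linarith)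
      _ = 2 ^ α * t ^ (-α) := by
          rw [Real.div_rpow ht.le zero_le_two, Real.rpow_neg zero_le_two, div_inv_eq_mul, mul_comm]
      _ ≤ 4 * t ^ (-α) := by
          have h : (2 : ℝ) ^ α ≤ 2 ^ (2 : ℝ) := Real.rpow_le_rpow_of_exponent_le one_le_two hα2
          norm_num at h
          gcongr
  have hint : IntervalIntegrable (fun τ : ℝ => (1 + τ) ^ (-α)) volume s t := by
    refine ContinuousOn.intervalIntegrable fun τ hτ => ContinuousAt.continuousWithinAt ?_
    rw [uIcc_of_le hst] at hτ
    have hτs : s ≤ τ := hτ.1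
    exact (continuousAt_const.add continuousAt_id).rpow_const (Or.inl (by simp; linarith))
  have h := intervalIntegral.integral_mono_on hst hint intervalIntegrable_const hbound
  rwa [intervalIntegral.integral_const, smul_eq_mul, mul_comm] at h

/-- A nonnegative function whose increments on `[t/2, t]` are controlled by slope `K t^(-α)` satisfies
a pointwise bound in terms of its area over `[t/2, t]`. -/
theorem mul_rpow_mul_le_area {K α δ t : ℝ} {f : ℝ → ℝ} (hK : 0 ≤ K) (hα2 : α ≤ 2)
    (hδ : 0 < δ) (hδ2 : δ ≤ 1 / 2) (ht : 1 ≤ t)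
    (hf_nonneg : ∀ s ∈ Icc (t / 2) t, 0 ≤ f s)
    (hf_slope : ∀ s ∈ Icc (t / 2) t, f t - f s ≤ K * t ^ (-α) * (t - s))
    (hf_int : IntervalIntegrable f volume (t / 2) t) :
    δ * (t ^ (α / 2) * f t) ≤ (∫ s in (t / 2)..t, f s) + K * δ ^ 2 := by
  have ht0 : 0 < t := by linarith
  set h := δ * t ^ (α / 2) with h_def
  have h0 : 0 ≤ h := by positivity
  have hpow : t ^ (α / 2) ≤ t := by
    simpa using Real.rpow_le_rpow_of_exponent_le ht (by linarith : α / 2 ≤ 1)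
  have hht : h ≤ t / 2 := by
    calc h ≤ 1 / 2 * t := mul_le_mul hδ2 hpow (by positivity) (by norm_num)
      _ = t / 2 := by ring
  have hsub : uIcc (t - h) t ⊆ uIcc (t / 2) t := by
    rw [uIcc_of_le (by linarith), uIcc_of_le (by linarith)]
    exact Icc_subset_Icc_left (by linarith)
  have hlower : ∀ s ∈ Icc (t - h) t, f t - K * t ^ (-α) * h ≤ f s := fun s hs => by
    have hst : t - h ≤ s := hs.1
    have h1 := hf_slope s ⟨by linarith, hs.2⟩
    have h2 : K * t ^ (-α) * (t - s) ≤ K * t ^ (-α) * h := by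
      gcongr
      linarith
    linarith
  have hconst := intervalIntegral.integral_mono_on (by linarith) intervalIntegrable_const
    (hf_int.mono_set hsub) hlower
  rw [intervalIntegral.integral_const, smul_eq_mul] at hconst
  have hmono : ∫ s in (t - h)..t, f s ≤ ∫ s in (t / 2)..t, f s := by
    refine intervalIntegral.integral_mono_interval (by linarith) (by linarith) le_rfl ?_ hf_int
    filter_upwards [ae_restrict_mem measurableSet_Ioc] with s hs
    exact hf_nonneg s (Ioc_subset_Icc_self hs)
  have hcancel : t ^ (-α) * (t ^ (α / 2) * t ^ (α / 2)) = 1 := by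
    rw [← Real.rpow_add ht0, ← Real.rpow_add ht0]
    ring_nf
    exact Real.rpow_zero t
  have hexpand : (t - (t - h)) * (f t - K * t ^ (-α) * h)
      = δ * (t ^ (α / 2) * f t) - K * δ ^ 2 := by
    rw [h_def]
    linear_combination (-K * δ ^ 2) * hcancel
  linarith

/-- The area of an integrable function over `[t/2, t]` vanishes as `t → ∞`. -/
theorem tendsto_integral_half_self {f : ℝ → ℝ} (hf : IntegrableOn f (Ici 0)) :
    Tendsto (fun t : ℝ => ∫ s in (t / 2)..t, f s) atTop (nhds 0) := by
  have hlim := intervalIntegral_tendsto_integral_Ioi 0 (hf.mono_set Ioi_subset_Ici_self) tendsto_id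
  have hdiff := hlim.sub (hlim.comp (tendsto_id.atTop_div_const (zero_lt_two' ℝ)))
  rw [sub_self] at hdiff
  refine hdiff.congr' ?_
  filter_upwards [eventually_ge_atTop 0] with t ht
  have hint : ∀ b, 0 ≤ b → IntervalIntegrable f volume 0 b := fun b hb =>
    (hf.mono_set (by rw [uIcc_of_le hb]; exact Icc_subset_Ici_self)).intervalIntegrable
  exact intervalIntegral.integral_interval_sub_left (hint t ht) (hint (t / 2) (by positivity))

/-- **Area Inequality, L¹ case** (Theorem 1.3 of the paper, case `β = γ = 0`).
If `f ≥ 0` is locally Lipschitz on `[0,∞)`, satisfies the integrated derivative bound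
`f t - f s ≤ C0 ∫_s^t (1+τ)^(-α) dτ` with `0 < α ≤ 2`, and is integrable on `[0,∞)`,
then `f t = o(t^(-α/2))` as `t → ∞`, i.e. `t^(α/2) f t → 0`. -/
theorem area_inequality_L1
    (C0 α : ℝ) (f : ℝ → ℝ)
    (hC0 : 0 ≤ C0) (hα0 : 0 < α) (hα2 : α ≤ 2)
    (hf_nonneg : ∀ t ∈ Ici (0:ℝ), 0 ≤ f t)
    (hf_lip : LocallyLipschitzOn (Ici 0) f)
    (hf_deriv : ∀ s t : ℝ, 0 ≤ s → s ≤ t →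
      f t - f s ≤ C0 * ∫ τ in s..t, (1 + τ) ^ (-α))
    (hf_int : IntegrableOn f (Ici 0)) :
    Tendsto (fun t : ℝ => t ^ (α / 2) * f t) atTop (nhds 0) := by
  have hslope : ∀ t, 1 ≤ t → ∀ s ∈ Icc (t / 2) t, f t - f s ≤ 4 * C0 * t ^ (-α) * (t - s) :=
    fun t ht s hs => by
      have hts : t / 2 ≤ s := hs.1
      calc f t - f s ≤ C0 * ∫ τ in s..t, (1 + τ) ^ (-α) := hf_deriv s t (by linarith) hs.2
        _ ≤ C0 * (4 * t ^ (-α) * (t - s)) := by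
            gcongr
            exact integral_one_add_rpow_neg_le hα0 hα2 (by linarith) hts hs.2
        _ = 4 * C0 * t ^ (-α) * (t - s) := by ring
  rw [Metric.tendsto_atTop']
  intro ε hε
  obtain ⟨δ, hδ, hδ2, hδε⟩ : ∃ δ : ℝ, 0 < δ ∧ δ ≤ 1 / 2 ∧ 4 * C0 * δ ≤ ε / 2 := by
    refine ⟨min (1 / 2) (ε / (8 * (C0 + 1))), by positivity, min_le_left _ _, ?_⟩
    calc 4 * C0 * min (1 / 2) (ε / (8 * (C0 + 1)))
        ≤ 4 * (C0 + 1) * (ε / (8 * (C0 + 1))) := by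
          gcongr
          · linarith
          · exact min_le_right _ _
      _ = ε / 2 := by
          field_simp
          norm_num
  obtain ⟨N, hN⟩ := eventually_atTop.1
    ((tendsto_integral_half_self hf_int).eventually_lt_const (by positivity : 0 < δ * (ε / 2)))
  refine ⟨max 1 N, fun t ht => ?_⟩
  have ht1 : 1 ≤ t := (le_max_left 1 N).trans ht.le
  have hft := hf_nonneg t (mem_Ici.2 (by linarith))
  have hint : IntervalIntegrable f volume (t / 2) t := by
    refine (hf_int.mono_set fun s hs => ?_).intervalIntegrable
    rw [uIcc_of_le (by linarith)] at hs
    exact mem_Ici.2 (by linarith [hs.1])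
  have hkey := mul_rpow_mul_le_area (by positivity) hα2 hδ hδ2 ht1
    (fun s hs => hf_nonneg s (mem_Ici.2 (by linarith [hs.1]))) (hslope t ht1) hint
  have harea := hN t ((le_max_right 1 N).trans ht.le)
  rw [Real.dist_eq, sub_zero, abs_of_nonneg (by positivity)]
  refine lt_of_mul_lt_mul_left ?_ hδ.le
  have hquad : 4 * C0 * δ ^ 2 ≤ δ * (ε / 2) := by
    calc 4 * C0 * δ ^ 2 = δ * (4 * C0 * δ) := by ring
      _ ≤ δ * (ε / 2) := by gcongr
  linarith
end

section
/- Let C0 > 0, 0 < α ≤ 2, and ε > 0. Then there exist a function g : [0,∞) → [0,∞) and a sequence t_n → ∞ such that: g is locally Lipschitz; g(t) − g(s) ≤ C0 ∫_s^t (1+τ)^(−α) dτ for all 0 ≤ s ≤ t; ∫_0^∞ g(t) dt < ∞; and g(t_n) = (1+t_n)^(−α/2−ε) for every n. In particular, g is not o(t^(−α/2−ε)) as t → ∞, so the decay exponent α/2 in the Area Inequality cannot be improved. -/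
open MeasureTheory Filter Set

/-- The tent function of height `h` centred at `c` whose sides have slope `k`. -/
noncomputable def tent (c h k x : ℝ) : ℝ := max 0 (h - k * |x - c|)

lemma tent_nonneg (c h k x : ℝ) : 0 ≤ tent c h k x := le_max_left _ _

lemma tent_self {h : ℝ} (hh : 0 ≤ h) (c k : ℝ) : tent c h k c = h := by
  simp [tent, hh]

lemma tent_le {h k : ℝ} (hh : 0 ≤ h) (hk : 0 ≤ k) (c x : ℝ) : tent c h k x ≤ h :=
  max_le hh (sub_le_self _ (by positivity))

lemma tent_eq_zero {c h k x : ℝ} (hx : h ≤ k * |x - c|) : tent c h k x = 0 :=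
  max_eq_left (by linarith)

lemma tent_le_add {k : ℝ} (hk : 0 ≤ k) (c h x y : ℝ) :
    tent c h k x ≤ tent c h k y + k * |x - y| := by
  refine max_le (add_nonneg (tent_nonneg _ _ _ _) (by positivity)) ?_
  have h1 : h - k * |y - c| ≤ tent c h k y := le_max_right _ _
  have h2 : k * |y - c| ≤ k * (|x - c| + |x - y|) := by
    gcongr
    rw [abs_sub_comm x y, add_comm]
    exact abs_sub_le y x c
  linarith

lemma tent_antitoneOn {k : ℝ} (hk : 0 ≤ k) (c h : ℝ) : AntitoneOn (tent c h k) (Ici c) := by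
  intro x hx y hy hxy
  have hx' : c ≤ x := hx
  refine max_le_max le_rfl (sub_le_sub_left (mul_le_mul_of_nonneg_left ?_ hk) h)
  rw [abs_of_nonneg (by linarith), abs_of_nonneg (by linarith)]
  linarith

lemma intervalIntegrable_one_add_rpow (r : ℝ) {s u : ℝ} (hs : 0 ≤ s) (hu : 0 ≤ u) :
    IntervalIntegrable (fun τ : ℝ => (1 + τ) ^ r) volume s u := by
  refine ContinuousOn.intervalIntegrable fun τ hτ => ?_
  have : 0 ≤ τ := (le_min hs hu).trans hτ.1
  exact ((continuousAt_const.add continuousAt_id).rpow_const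
    (Or.inl (show (1 : ℝ) + τ ≠ 0 by positivity))).continuousWithinAt

/-- A tent whose slope is at most the value of a decreasing rate at its centre grows no faster
than that rate. -/
lemma tent_sub_le_integral {C α c h s u : ℝ} (hC : 0 ≤ C) (hα : 0 ≤ α) (hc : 0 ≤ c)
    (hs : 0 ≤ s) (hsu : s ≤ u) :
    tent c h (C * (1 + c) ^ (-α)) u - tent c h (C * (1 + c) ^ (-α)) s ≤
      C * ∫ τ in s..u, (1 + τ) ^ (-α) := by
  have rate_nonneg : ∀ a b : ℝ, 0 ≤ a → a ≤ b → 0 ≤ ∫ τ in a..b, (1 + τ) ^ (-α) :=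
    fun a b ha hab => intervalIntegral.integral_nonneg hab fun τ hτ => by
      have : 0 ≤ τ := ha.trans hτ.1
      positivity
  rcases le_total c s with hcs | hsc
  · have := tent_antitoneOn (k := C * (1 + c) ^ (-α)) (by positivity) c h
      (mem_Ici.2 hcs) (mem_Ici.2 (hcs.trans hsu)) hsu
    have := mul_nonneg hC (rate_nonneg s u hs hsu)
    linarith
  · set k := C * (1 + c) ^ (-α) with hk_def
    have hk : 0 ≤ k := by positivity
    have hsm : s ≤ min u c := le_min hsu hsc
    have hm : 0 ≤ min u c := hs.trans hsm
    have h1 : tent c h k u ≤ tent c h k (min u c) := by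
      rcases le_total u c with huc | hcu
      · rw [min_eq_left huc]
      · rw [min_eq_right hcu]
        exact tent_antitoneOn hk c h (mem_Ici.2 le_rfl) (mem_Ici.2 hcu) hcu
    have h2 := tent_le_add hk c h (min u c) s
    rw [abs_of_nonneg (by linarith)] at h2
    have h3 : (min u c - s) * (1 + c) ^ (-α) ≤ ∫ τ in s..min u c, (1 + τ) ^ (-α) := by
      rw [← smul_eq_mul, ← intervalIntegral.integral_const]
      refine intervalIntegral.integral_mono_on hsm intervalIntegrable_const
        (intervalIntegrable_one_add_rpow _ hs hm) fun τ hτ => ?_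
      have h0 : 0 ≤ τ := hs.trans hτ.1
      have hτc : τ ≤ c := hτ.2.trans (min_le_right _ _)
      exact Real.rpow_le_rpow_of_nonpos (by linarith) (by linarith) (by linarith)
    have h4 := intervalIntegral.integral_add_adjacent_intervals
      (intervalIntegrable_one_add_rpow (-α) hs hm)
      (intervalIntegrable_one_add_rpow (-α) hm (hs.trans hsu))
    have h5 := rate_nonneg (min u c) u hm (min_le_left _ _)
    calc tent c h k u - tent c h k s ≤ C * ((min u c - s) * (1 + c) ^ (-α)) := by
          rw [hk_def] at *; linarith
      _ ≤ C * ∫ τ in s..u, (1 + τ) ^ (-α) := by gcongr; linarith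

lemma lintegral_tent_le {h k w : ℝ} (hh : 0 ≤ h) (hk : 0 < k) (hw : h = k * w) (c : ℝ) :
    ∫⁻ x, ENNReal.ofReal (tent c h k x) ≤ ENNReal.ofReal (2 * (h * w)) := by
  calc ∫⁻ x, ENNReal.ofReal (tent c h k x)
      ≤ ∫⁻ x, (Icc (c - w) (c + w)).indicator (fun _ => ENNReal.ofReal h) x := by
        refine lintegral_mono fun x => ?_
        by_cases hx : x ∈ Icc (c - w) (c + w)
        · rw [indicator_of_mem hx]
          exact ENNReal.ofReal_le_ofReal (tent_le hh hk.le c x)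
        · rw [tent_eq_zero]
          · simp
          · rw [hw]
            refine mul_le_mul_of_nonneg_left ?_ hk.le
            by_contra! hlt
            rw [abs_lt] at hlt
            exact hx ⟨by linarith, by linarith⟩
    _ = ENNReal.ofReal (2 * (h * w)) := by
        rw [lintegral_indicator_const measurableSet_Icc, Real.volume_Icc,
          ← ENNReal.ofReal_mul hh]
        congr 1
        ring

section Supremum

variable {ι : Type*} {f : ι → ℝ → ℝ} {M : ℝ}

lemma bddAbove_range_of_le (hM : ∀ i x, f i x ≤ M) (x : ℝ) : BddAbove (range fun i => f i x) :=
  ⟨M, by rintro _ ⟨i, rfl⟩; exact hM i x⟩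

lemma lipschitzWith_iSup [Nonempty ι] {K : NNReal} (hM : ∀ i x, f i x ≤ M)
    (hf : ∀ i x y, f i x ≤ f i y + K * |x - y|) : LipschitzWith K fun x => ⨆ i, f i x := by
  refine LipschitzWith.of_le_add_mul K fun x y => ciSup_le fun i => (hf i x y).trans ?_
  rw [Real.dist_eq]
  gcongr
  exact le_ciSup (bddAbove_range_of_le hM y) i

lemma ofReal_iSup_le_tsum [Nonempty ι] (x : ℝ) :
    ENNReal.ofReal (⨆ i, f i x) ≤ ∑' i, ENNReal.ofReal (f i x) := by
  by_cases htop : ∑' i, ENNReal.ofReal (f i x) = ⊤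
  · simp [htop]
  · refine ENNReal.ofReal_le_of_le_toReal (ciSup_le fun i => ?_)
    exact (ENNReal.ofReal_le_iff_le_toReal htop).1
      (ENNReal.le_tsum (f := fun i => ENNReal.ofReal (f i x)) i)

lemma integrable_iSup [Countable ι] [Nonempty ι] {K : NNReal} {a : ι → ℝ}
    (hM : ∀ i x, f i x ≤ M) (h0 : ∀ i x, 0 ≤ f i x)
    (hf : ∀ i x y, f i x ≤ f i y + K * |x - y|) (ha : Summable a)
    (ha0 : ∀ i, 0 ≤ a i) (hfa : ∀ i, ∫⁻ x, ENNReal.ofReal (f i x) ≤ ENNReal.ofReal (a i)) :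
    Integrable fun x => ⨆ i, f i x := by
  have hcont : Continuous fun x => ⨆ i, f i x := (lipschitzWith_iSup hM hf).continuous
  have hfi : ∀ i, Continuous (f i) := fun i =>
    (LipschitzWith.of_le_add_mul K fun x y => by rw [Real.dist_eq]; exact hf i x y).continuous
  refine ⟨hcont.aestronglyMeasurable, ?_⟩
  rw [hasFiniteIntegral_iff_ofReal (ae_of_all _ fun x => Real.iSup_nonneg fun i => h0 i x)]
  calc ∫⁻ x, ENNReal.ofReal (⨆ i, f i x)
      ≤ ∫⁻ x, ∑' i, ENNReal.ofReal (f i x) := lintegral_mono fun x => ofReal_iSup_le_tsum x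
    _ = ∑' i, ∫⁻ x, ENNReal.ofReal (f i x) :=
        lintegral_tsum fun i => (hfi i).measurable.ennreal_ofReal.aemeasurable
    _ ≤ ∑' i, ENNReal.ofReal (a i) := ENNReal.tsum_le_tsum hfa
    _ = ENNReal.ofReal (∑' i, a i) := (ENNReal.ofReal_tsum_of_nonneg ha0 ha).symm
    _ < ⊤ := ENNReal.ofReal_lt_top

end Supremum

/-- In a geometric progression of ratio at least `2`, distinct terms are at distance at least half
of either. -/
lemma half_pow_le_abs_sub {R : ℝ} (hR : 2 ≤ R) {m n : ℕ} (hmn : m ≠ n) :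
    R ^ m / 2 ≤ |R ^ n - R ^ m| := by
  have step : ∀ a b : ℕ, a < b → 2 * R ^ a ≤ R ^ b := fun a b hab => by
    have h1 : R ^ (a + 1) ≤ R ^ b := pow_le_pow_right₀ (by linarith) hab
    have h2 : 0 < R ^ a := by positivity
    rw [pow_succ] at h1
    nlinarith
  have hm : 0 < R ^ m := by positivity
  rcases hmn.lt_or_gt with h | h
  · exact le_abs.2 (Or.inl (by linarith [step m n h]))
  · exact le_abs.2 (Or.inr (by linarith [step n m h]))

/-- **Optimality of the Area Inequality decay exponent** (Theorem 1.3 of the paper).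
For `C0 > 0`, `0 < α ≤ 2` and `ε > 0` there are a nonnegative, locally Lipschitz function
`g` on `[0,∞)` satisfying the integrated derivative bound
`g t - g s ≤ C0 ∫_s^t (1+τ)^(-α) dτ`, integrable on `[0,∞)`, and a sequence `tₙ → ∞`
with `g tₙ = (1 + tₙ)^(-α/2 - ε)` for all `n`; hence `g` is not `o(t^(-α/2-ε))`. -/
theorem area_inequality_optimal
    (C0 α ε : ℝ) (hC0 : 0 < C0) (hα0 : 0 < α) (hα2 : α ≤ 2) (hε : 0 < ε) :
    ∃ (g : ℝ → ℝ) (t : ℕ → ℝ),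
      Tendsto t atTop atTop ∧
      (∀ s ∈ Ici (0:ℝ), 0 ≤ g s) ∧
      LocallyLipschitzOn (Ici 0) g ∧
      (∀ s u : ℝ, 0 ≤ s → s ≤ u →
        g u - g s ≤ C0 * ∫ τ in s..u, (1 + τ) ^ (-α)) ∧
      IntegrableOn g (Ici 0) ∧
      (∀ n : ℕ, g (t n) = (1 + t n) ^ (-α / 2 - ε)) := by
  obtain ⟨R, hR2, hRε⟩ : ∃ R : ℝ, 2 ≤ R ∧ 2 / C0 ≤ R ^ ε :=
    ((eventually_ge_atTop 2).and ((tendsto_rpow_atTop hε).eventually_ge_atTop _)).exists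
  have hR0 : 0 < R := by linarith
  set T : ℕ → ℝ := fun n => R ^ (n + 1)
  have hRT : ∀ n, R ≤ T n := fun n => le_self_pow₀ (by linarith) n.succ_ne_zero
  have hT1 : ∀ n, 1 ≤ T n := fun n => by linarith [hRT n]
  have hT0 : ∀ n, 0 < T n := fun n => by linarith [hT1 n]
  set t : ℕ → ℝ := fun n => T n - 1
  have htT : ∀ n, 1 + t n = T n := fun n => add_sub_cancel 1 (T n)
  have ht0 : ∀ n, 0 ≤ t n := fun n => sub_nonneg.2 (hT1 n)
  set h : ℕ → ℝ := fun n => T n ^ (-α / 2 - ε)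
  set k : ℕ → ℝ := fun n => C0 * (1 + t n) ^ (-α) with hk_def
  set w : ℕ → ℝ := fun n => T n ^ (α / 2 - ε) / C0
  have hh0 : ∀ n, 0 ≤ h n := fun n => Real.rpow_nonneg (hT0 n).le _
  have hh1 : ∀ n, h n ≤ 1 := fun n => Real.rpow_le_one_of_one_le_of_nonpos (hT1 n) (by linarith)
  have hk0 : ∀ n, 0 < k n := fun n => by
    have := hT0 n
    simp only [hk_def, htT]
    positivity
  have hkC : ∀ n, k n ≤ C0 := fun n => by
    simp only [hk_def, htT]
    exact mul_le_of_le_one_right hC0.le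
      (Real.rpow_le_one_of_one_le_of_nonpos (hT1 n) (by linarith))
  have hhw : ∀ n, h n = k n * w n := fun n => by
    simp only [h, w, hk_def, htT]
    rw [mul_div_assoc', mul_assoc, ← Real.rpow_add (hT0 n), mul_div_cancel_left₀ _ hC0.ne']
    congr 1
    ring
  have hw_half : ∀ n, w n ≤ T n / 2 := fun n => by
    have h1 : T n ^ (α / 2 - ε) ≤ T n ^ (1 - ε) :=
      Real.rpow_le_rpow_of_exponent_le (hT1 n) (by linarith)
    have h2 : 2 / C0 ≤ T n ^ ε := hRε.trans (Real.rpow_le_rpow hR0.le (hRT n) hε.le)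
    have h3 : T n ^ (1 - ε) * T n ^ ε = T n := by
      rw [← Real.rpow_add (hT0 n), sub_add_cancel, Real.rpow_one]
    have h4 : T n ^ (1 - ε) * (2 / C0) ≤ T n :=
      (mul_le_mul_of_nonneg_left h2 (Real.rpow_nonneg (hT0 n).le _)).trans_eq h3
    calc w n ≤ T n ^ (1 - ε) / C0 := div_le_div_of_nonneg_right h1 hC0.le
      _ = T n ^ (1 - ε) * (2 / C0) / 2 := by ring
      _ ≤ T n / 2 := by linarith
  set f : ℕ → ℝ → ℝ := fun n => tent (t n) (h n) (k n)
  have hf0 : ∀ n x, 0 ≤ f n x := fun n x => tent_nonneg _ _ _ _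
  have hf1 : ∀ n x, f n x ≤ 1 := fun n x => (tent_le (hh0 n) (hk0 n).le _ x).trans (hh1 n)
  have hf_lip : ∀ n x y, f n x ≤ f n y + (⟨C0, hC0.le⟩ : NNReal) * |x - y| := fun n x y =>
    (tent_le_add (hk0 n).le _ _ x y).trans (by gcongr; exact hkC n)
  have harea : ∀ n, h n * w n = (R ^ (-(2 * ε))) ^ (n + 1) / C0 := fun n => by
    have hTn : T n = R ^ ((n + 1 : ℕ) : ℝ) := (Real.rpow_natCast R (n + 1)).symm
    simp only [h, w]
    rw [mul_div_assoc', ← Real.rpow_add (hT0 n), hTn, ← Real.rpow_natCast,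
      ← Real.rpow_mul hR0.le, ← Real.rpow_mul hR0.le]
    ring_nf
  have hsum : Summable fun n => 2 * (h n * w n) := by
    simp only [harea]
    have hgeom := summable_geometric_of_lt_one (Real.rpow_nonneg hR0.le (-(2 * ε)))
      (Real.rpow_lt_one_of_one_lt_of_neg (by linarith) (by linarith))
    exact (((summable_nat_add_iff 1).2 hgeom).div_const C0).mul_left 2
  refine ⟨fun x => ⨆ n, f n x, t, ?_, fun s _ => Real.iSup_nonneg fun n => hf0 n s,
    (lipschitzWith_iSup hf1 hf_lip).locallyLipschitz.locallyLipschitzOn, ?_, ?_, ?_⟩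
  · exact tendsto_atTop_add_const_right _ (-1 : ℝ)
      ((tendsto_add_atTop_iff_nat 1).2 (tendsto_pow_atTop_atTop_of_one_lt (by linarith)))
  · intro s u hs hsu
    rw [sub_le_iff_le_add]
    refine ciSup_le fun n => ?_
    have h1 := tent_sub_le_integral (h := h n) hC0.le hα0.le (ht0 n) hs hsu
    have h2 : f n s ≤ ⨆ n, f n s := le_ciSup (bddAbove_range_of_le hf1 s) n
    linarith
  · refine (integrable_iSup hf1 hf0 hf_lip hsum (fun n => ?_)
      fun n => lintegral_tent_le (hh0 n) (hk0 n) (hhw n) (t n)).integrableOn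
    rw [harea]
    positivity
  · intro n
    rw [htT]
    refine le_antisymm (ciSup_le fun m => ?_) ?_
    · rcases eq_or_ne m n with rfl | hmn
      · exact tent_le (hh0 m) (hk0 m).le _ _
      · have hfar : w m ≤ |t n - t m| := (hw_half m).trans <| by
          simpa [t, T] using half_pow_le_abs_sub hR2 (add_left_injective 1 |>.ne hmn)
        refine (tent_eq_zero ?_).trans_le (hh0 n)
        rw [hhw]
        exact mul_le_mul_of_nonneg_left hfar (hk0 m).le
    · exact (tent_self (hh0 n) (t n) (k n)).symm.trans_le
        (le_ciSup (bddAbove_range_of_le hf1 (t n)) n)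
end

section
/- Let ν > 0, u_− > 0, c > 0, σ ≠ 0, h = u_−/ν, and let ũ(x) = −u_− + 2u_− c/(e^{hx} + c) be the viscous shock profile. For t ≥ 0 define d(t) = (1/√(2π)) ∫_ℝ ( sup_{x∈ℝ} |ũ(x) − ũ(x + σ√t z)| ) e^{−z²/2} dz. Then d(0) = 0, d is nondecreasing on [0,∞), and lim_{t→∞} d(t) = 2u_− = u_− − u_+. -/
open Filter Set MeasureTheory

/-- The `L^∞` distance between a function and its translate by `y`. -/
noncomputable def shiftSupDist (f : ℝ → ℝ) (y : ℝ) : ℝ := ⨆ x : ℝ, |f x - f (x + y)|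

lemma shiftSupDist_zero (f : ℝ → ℝ) : shiftSupDist f 0 = 0 := by
  simp [shiftSupDist]

lemma shiftSupDist_neg (f : ℝ → ℝ) (y : ℝ) : shiftSupDist f (-y) = shiftSupDist f y := by
  unfold shiftSupDist
  rw [← (Equiv.addRight y).iSup_comp]
  refine iSup_congr fun x => ?_
  simp [abs_sub_comm]

lemma shiftSupDist_abs (f : ℝ → ℝ) (y : ℝ) : shiftSupDist f |y| = shiftSupDist f y := by
  rcases abs_choice y with h | h <;> rw [h]
  exact shiftSupDist_neg f y

lemma shiftSupDist_nonneg (f : ℝ → ℝ) (y : ℝ) : 0 ≤ shiftSupDist f y :=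
  Real.iSup_nonneg fun _ => abs_nonneg _

section Antitone

variable {f : ℝ → ℝ} {a b : ℝ}

lemma abs_sub_shift_le (hf : ∀ x, f x ∈ Icc a b) (x y : ℝ) : |f x - f (x + y)| ≤ b - a :=
  abs_sub_le_of_le_of_le (hf x).1 (hf x).2 (hf _).1 (hf _).2

lemma bddAbove_abs_sub_shift (hf : ∀ x, f x ∈ Icc a b) (y : ℝ) :
    BddAbove (range fun x => |f x - f (x + y)|) :=
  ⟨b - a, by rintro _ ⟨x, rfl⟩; exact abs_sub_shift_le hf x y⟩

lemma shiftSupDist_le (hf : ∀ x, f x ∈ Icc a b) (y : ℝ) : shiftSupDist f y ≤ b - a :=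
  ciSup_le fun x => abs_sub_shift_le hf x y

lemma shiftSupDist_mono_abs (hanti : Antitone f) (hf : ∀ x, f x ∈ Icc a b) {y z : ℝ}
    (h : |y| ≤ |z|) : shiftSupDist f y ≤ shiftSupDist f z := by
  rw [← shiftSupDist_abs f y, ← shiftSupDist_abs f z]
  refine ciSup_mono (bddAbove_abs_sub_shift hf _) fun x => ?_
  have h1 : f (x + |y|) ≤ f x := hanti (by linarith [abs_nonneg y])
  have h2 : f (x + |z|) ≤ f (x + |y|) := hanti (by linarith)
  rw [abs_of_nonneg (sub_nonneg.mpr h1), abs_of_nonneg (sub_nonneg.mpr (h2.trans h1))]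
  linarith

lemma measurable_shiftSupDist (hanti : Antitone f) (hf : ∀ x, f x ∈ Icc a b) :
    Measurable (shiftSupDist f) := by
  have hm : Monotone fun r : ℝ => shiftSupDist f (max r 0) := fun r s hrs =>
    shiftSupDist_mono_abs hanti hf (by
      rw [abs_of_nonneg (le_max_right _ _), abs_of_nonneg (le_max_right _ _)]
      exact max_le_max_right 0 hrs)
  have he : shiftSupDist f = (fun r : ℝ => shiftSupDist f (max r 0)) ∘ fun y => |y| := by
    ext y
    simp [shiftSupDist_abs]
  rw [he]
  exact hm.measurable.comp measurable_abs

lemma tendsto_shiftSupDist_atTop (hf : ∀ x, f x ∈ Icc a b)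
    (hbot : Tendsto f atBot (nhds b)) (htop : Tendsto f atTop (nhds a)) :
    Tendsto (shiftSupDist f) atTop (nhds (b - a)) := by
  have h2 : Tendsto (fun r : ℝ => r / 2) atTop atTop := tendsto_id.atTop_div_const two_pos
  refine tendsto_of_tendsto_of_tendsto_of_le_of_le
    ((hbot.comp (tendsto_neg_atTop_atBot.comp h2)).sub (htop.comp h2)) tendsto_const_nhds
    (fun r => ?_) (shiftSupDist_le hf)
  refine le_trans ?_ (le_ciSup (bddAbove_abs_sub_shift hf r) (-(r / 2)))
  have he : -(r / 2) + r = r / 2 := by ring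
  simpa [he] using le_abs_self (f (-(r / 2)) - f (r / 2))

lemma integrable_exp_neg_sq_div_two : Integrable fun z : ℝ => Real.exp (-z ^ 2 / 2) := by
  convert integrable_exp_neg_mul_sq (b := 1 / 2) (by norm_num) using 3
  ring

lemma integral_exp_neg_sq_div_two :
    ∫ z : ℝ, Real.exp (-z ^ 2 / 2) = Real.sqrt (2 * Real.pi) := by
  have h := integral_gaussian (1 / 2)
  rw [show Real.pi / (1 / 2) = 2 * Real.pi by ring] at h
  rw [← h]
  congr 1
  ext z
  ring_nf

lemma norm_shiftSupDist_mul_exp_le (hf : ∀ x, f x ∈ Icc a b) (y z : ℝ) :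
    ‖shiftSupDist f y * Real.exp (-z ^ 2 / 2)‖ ≤ (b - a) * Real.exp (-z ^ 2 / 2) := by
  rw [Real.norm_of_nonneg (mul_nonneg (shiftSupDist_nonneg f y) (Real.exp_pos _).le)]
  exact mul_le_mul_of_nonneg_right (shiftSupDist_le hf y) (Real.exp_pos _).le

lemma measurable_shiftSupDist_mul_exp (hanti : Antitone f) (hf : ∀ x, f x ∈ Icc a b) (s : ℝ) :
    Measurable fun z : ℝ => shiftSupDist f (s * z) * Real.exp (-z ^ 2 / 2) :=
  ((measurable_shiftSupDist hanti hf).comp (measurable_const_mul s)).mul (by fun_prop)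

lemma integrable_shiftSupDist_mul_exp (hanti : Antitone f) (hf : ∀ x, f x ∈ Icc a b) (s : ℝ) :
    Integrable fun z : ℝ => shiftSupDist f (s * z) * Real.exp (-z ^ 2 / 2) :=
  (integrable_exp_neg_sq_div_two.const_mul (b - a)).mono'
    (measurable_shiftSupDist_mul_exp hanti hf s).aestronglyMeasurable
    (Eventually.of_forall fun z => norm_shiftSupDist_mul_exp_le hf (s * z) z)

lemma integral_shiftSupDist_mul_exp_mono (hanti : Antitone f) (hf : ∀ x, f x ∈ Icc a b)
    {r s : ℝ} (hrs : |r| ≤ |s|) :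
    ∫ z : ℝ, shiftSupDist f (r * z) * Real.exp (-z ^ 2 / 2) ≤
      ∫ z : ℝ, shiftSupDist f (s * z) * Real.exp (-z ^ 2 / 2) := by
  refine integral_mono (integrable_shiftSupDist_mul_exp hanti hf r)
    (integrable_shiftSupDist_mul_exp hanti hf s) fun z => ?_
  refine mul_le_mul_of_nonneg_right (shiftSupDist_mono_abs hanti hf ?_) (Real.exp_pos _).le
  rw [abs_mul, abs_mul]
  gcongr

lemma tendsto_integral_shiftSupDist_mul_exp (hanti : Antitone f) (hf : ∀ x, f x ∈ Icc a b)
    (hbot : Tendsto f atBot (nhds b)) (htop : Tendsto f atTop (nhds a))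
    {s : ℝ → ℝ} (hs : Tendsto (fun t => |s t|) atTop atTop) :
    Tendsto (fun t => ∫ z : ℝ, shiftSupDist f (s t * z) * Real.exp (-z ^ 2 / 2)) atTop
      (nhds ((b - a) * Real.sqrt (2 * Real.pi))) := by
  rw [← integral_exp_neg_sq_div_two, ← integral_const_mul]
  refine tendsto_integral_filter_of_dominated_convergence
    (fun z => (b - a) * Real.exp (-z ^ 2 / 2))
    (Eventually.of_forall fun t =>
      (measurable_shiftSupDist_mul_exp hanti hf (s t)).aestronglyMeasurable)
    (Eventually.of_forall fun t => Eventually.of_forall fun z =>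
      norm_shiftSupDist_mul_exp_le hf (s t * z) z)
    (integrable_exp_neg_sq_div_two.const_mul _) ?_
  filter_upwards [Measure.ae_ne volume (0 : ℝ)] with z hz
  refine Tendsto.mul_const _ ?_
  have h := (tendsto_shiftSupDist_atTop hf hbot htop).comp
    (hs.atTop_mul_const (abs_pos.mpr hz))
  refine h.congr fun t => ?_
  simp only [Function.comp_apply, ← abs_mul, shiftSupDist_abs]

end Antitone

section Profile

variable {h u c : ℝ}

lemma antitone_shockProfile (hh : 0 < h) (hu : 0 < u) (hc : 0 < c) :
    Antitone fun x : ℝ => -u + 2 * u * c / (Real.exp (h * x) + c) := by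
  intro x y hxy
  dsimp only
  gcongr

lemma tendsto_shockProfile_atBot (hh : 0 < h) (hc : 0 < c) :
    Tendsto (fun x : ℝ => -u + 2 * u * c / (Real.exp (h * x) + c)) atBot (nhds u) := by
  have he : Tendsto (fun x : ℝ => Real.exp (h * x)) atBot (nhds 0) :=
    Real.tendsto_exp_atBot.comp (tendsto_id.const_mul_atBot hh)
  have hd : (0 : ℝ) + c ≠ 0 := by positivity
  have hl := ((tendsto_const_nhds (x := 2 * u * c)).div (he.add_const c) hd).const_add (-u)
  have hv : -u + 2 * u * c / (0 + c) = u := by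
    field_simp
    ring
  rwa [hv] at hl

lemma tendsto_shockProfile_atTop (hh : 0 < h) :
    Tendsto (fun x : ℝ => -u + 2 * u * c / (Real.exp (h * x) + c)) atTop (nhds (-u)) := by
  have he : Tendsto (fun x : ℝ => Real.exp (h * x)) atTop atTop :=
    Real.tendsto_exp_atTop.comp (tendsto_id.const_mul_atTop hh)
  simpa using ((tendsto_atTop_add_const_right _ c he).const_div_atTop (2 * u * c)).const_add (-u)

end Profile

/-- **Instability of the viscous shock wave** (Theorem 1.4 of the paper). With the viscous
shock profile `ũ(x) = -u₋ + 2u₋c/(e^{hx}+c)`, `h = u₋/ν`, and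
`d(t) = E‖ũ(·) - ũ(· + σB(t))‖_{L^∞}
      = (1/√(2π)) ∫_ℝ (sup_x |ũ(x) - ũ(x + σ√t z)|) e^{-z²/2} dz`,
one has `d(0) = 0`, `d` is nondecreasing on `[0,∞)`, and `d(t) → 2u₋ = u₋ - u₊` as
`t → ∞`. -/
theorem viscous_shock_instability
    (ν um c σ : ℝ) (hν : 0 < ν) (hu : 0 < um) (hc : 0 < c) (hσ : σ ≠ 0)
    (ut : ℝ → ℝ)
    (hut : ∀ x : ℝ, ut x = -um + 2 * um * c / (Real.exp (um / ν * x) + c))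
    (d : ℝ → ℝ)
    (hd : ∀ t : ℝ, d t = (Real.sqrt (2 * Real.pi))⁻¹ *
      ∫ z : ℝ, (⨆ x : ℝ, |ut x - ut (x + σ * Real.sqrt t * z)|) * Real.exp (-z ^ 2 / 2)) :
    d 0 = 0 ∧ MonotoneOn d (Ici 0) ∧ Tendsto d atTop (nhds (2 * um)) := by
  have hh : 0 < um / ν := div_pos hu hν
  obtain rfl := funext hut
  have hanti := antitone_shockProfile hh hu hc
  have hbot := tendsto_shockProfile_atBot (u := um) hh hc
  have htop := tendsto_shockProfile_atTop (u := um) (c := c) hh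
  set f : ℝ → ℝ := fun x => -um + 2 * um * c / (Real.exp (um / ν * x) + c)
  have hf : ∀ x, f x ∈ Icc (-um) um := fun x =>
    ⟨hanti.le_of_tendsto htop x, hanti.ge_of_tendsto hbot x⟩
  have hd' : ∀ t, d t = (Real.sqrt (2 * Real.pi))⁻¹ *
      ∫ z : ℝ, shiftSupDist f (σ * Real.sqrt t * z) * Real.exp (-z ^ 2 / 2) := hd
  refine ⟨by simp [hd', shiftSupDist_zero], fun t _ t' _ htt' => ?_, ?_⟩
  · rw [hd', hd']
    refine mul_le_mul_of_nonneg_left (integral_shiftSupDist_mul_exp_mono hanti hf ?_)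
      (by positivity)
    rw [abs_mul, abs_mul, abs_of_nonneg (Real.sqrt_nonneg t), abs_of_nonneg (Real.sqrt_nonneg t')]
    gcongr
  · have hs : Tendsto (fun t => |σ * Real.sqrt t|) atTop atTop := by
      simp only [abs_mul, abs_of_nonneg (Real.sqrt_nonneg _)]
      exact Real.tendsto_sqrt_atTop.const_mul_atTop (abs_pos.mpr hσ)
    have hl := (tendsto_integral_shiftSupDist_mul_exp hanti hf hbot htop hs).const_mul
      (Real.sqrt (2 * Real.pi))⁻¹
    have hp : Real.sqrt (2 * Real.pi) ≠ 0 := by positivity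
    have hv : (Real.sqrt (2 * Real.pi))⁻¹ * ((um - -um) * Real.sqrt (2 * Real.pi)) = 2 * um := by
      field_simp
      ring
    rw [hv] at hl
    exact hl.congr fun t => (hd' t).symm
end
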